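/- Let f_n, n ≥ 1, be functions in the Hardy space H¹ of the unit disc with ‖f_n‖₁ ≤ 1, and suppose there is a measurable subset E of the unit circle 𝕋 with positive Lebesgue measure such that ∫_E |f_n(e^{iθ})| dθ → 0 as n → ∞. Then f_n(0) → 0 as n → ∞. -/

import Mathlib

open Complex Metric Set Filter MeasureTheory
open scoped Topology Real

/-- Jensen's inequality for analytic functions: `log ‖f‖` is at most its average over a circle. -/
lemma AnalyticOnNhd.log_norm_le_circleAverage {f : ℂ → ℂ} {c : ℂ} {R : ℝ} (hR : 0 < R)
    (hf : AnalyticOnNhd ℂ f (closedBall c R)) (hc : f c ≠ 0) :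
    Real.log ‖f c‖ ≤ Real.circleAverage (Real.log ‖f ·‖) c R := by
  rw [← abs_of_pos hR] at hf
  rw [hf.circleAverage_log_norm hR.ne' hc]
  refine le_add_of_nonneg_left (finsum_nonneg fun u => ?_)
  by_cases hu : u ∈ closedBall c |R|
  · refine mul_nonneg ?_ ?_
    · exact_mod_cast MeromorphicOn.AnalyticOnNhd.divisor_nonneg hf u
    · rcases eq_or_ne u c with rfl | huc
      · simp
      · have h0 : 0 < ‖c - u‖ := norm_pos_iff.2 (sub_ne_zero.2 huc.symm)
        apply Real.log_nonneg
        rw [← div_eq_mul_inv, one_le_div h0]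
        rwa [mem_closedBall, dist_comm, dist_eq_norm, abs_of_pos hR] at hu
  · simp [hu]

/-- A function analytic on a closed disc and nonzero at its center is nonzero at almost every
point of the boundary circle. -/
lemma AnalyticOnNhd.ae_circleMap_ne_zero {f : ℂ → ℂ} {c : ℂ} {R : ℝ} (hR : 0 < R)
    (hf : AnalyticOnNhd ℂ f (closedBall c R)) (hc : f c ≠ 0) :
    ∀ᵐ θ : ℝ, f (circleMap c R θ) ≠ 0 := by
  have h := hf.preimage_zero_mem_codiscreteWithin hc (mem_closedBall_self hR.le)
    ⟨⟨c, mem_closedBall_self hR.le⟩, (convex_closedBall c R).isPreconnected⟩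
  have h2 : f ⁻¹' {0}ᶜ ∈ codiscreteWithin (sphere c |R|) := by
    rw [abs_of_pos hR]
    exact codiscreteWithin_mono sphere_subset_closedBall h
  have h3 := circleMap_preimage_codiscrete hR.ne' h2
  have h4 := ae_restrict_le_codiscreteWithin (μ := (volume : Measure ℝ)) MeasurableSet.univ h3
  rw [Measure.restrict_univ] at h4
  exact h4

/-- A quantitative form of Jensen's inequality in which the mean of `‖f‖` over a subset `S` of the
circle is given the weight `a⁻¹`. -/
lemma AnalyticOnNhd.two_pi_mul_log_norm_le {f : ℂ → ℂ} {c : ℂ} {R : ℝ} (hR : 0 < R)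
    (hf : AnalyticOnNhd ℂ f (closedBall c R)) (hc : f c ≠ 0)
    {S : Set ℝ} (hS : MeasurableSet S) (hSsub : S ⊆ Ioc 0 (2 * π)) {a : ℝ} (ha : 0 < a) :
    2 * π * Real.log ‖f c‖ ≤ (∫ θ in (0:ℝ)..(2 * π), ‖f (circleMap c R θ)‖)
      + (a⁻¹ * (∫ θ in S, ‖f (circleMap c R θ)‖) + volume.real S * (Real.log a - 1)) := by
  have hpi : (0:ℝ) ≤ 2 * π := by positivity
  have hcont : Continuous fun θ => ‖f (circleMap c R θ)‖ :=
    (hf.continuousOn.comp_continuous (continuous_circleMap c R)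
      (fun θ => circleMap_mem_closedBall c hR.le θ)).norm
  have hint : IntegrableOn (fun θ => ‖f (circleMap c R θ)‖) (Ioc 0 (2 * π)) :=
    (hcont.intervalIntegrable 0 (2 * π)).1
  have hSfin : volume S ≠ ⊤ := ne_top_of_le_ne_top measure_Ioc_lt_top.ne (measure_mono hSsub)
  have hintS : IntegrableOn (fun θ => a⁻¹ * ‖f (circleMap c R θ)‖ + (Real.log a - 1)) S :=
    ((hint.mono_set hSsub).const_mul a⁻¹).add (integrableOn_const hSfin)
  have hlog : IntegrableOn (fun θ => Real.log ‖f (circleMap c R θ)‖) (Ioc 0 (2 * π)) := by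
    have : CircleIntegrable (Real.log ‖f ·‖) c R :=
      MeromorphicOn.circleIntegrable_log_norm fun z hz =>
        (hf z (sphere_subset_closedBall (by rwa [abs_of_pos hR] at hz))).meromorphicAt
    exact (show IntervalIntegrable _ _ _ _ from this).1
  have hJ := hf.log_norm_le_circleAverage hR hc
  rw [Real.circleAverage_def, smul_eq_mul, inv_mul_eq_div, le_div_iff₀' (by positivity)] at hJ
  refine hJ.trans ?_
  rw [intervalIntegral.integral_of_le hpi, intervalIntegral.integral_of_le hpi]
  have hSeq : a⁻¹ * (∫ θ in S, ‖f (circleMap c R θ)‖) + volume.real S * (Real.log a - 1)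
      = ∫ θ in Ioc 0 (2 * π),
        S.indicator (fun θ => a⁻¹ * ‖f (circleMap c R θ)‖ + (Real.log a - 1)) θ := by
    rw [setIntegral_indicator hS, inter_eq_self_of_subset_right hSsub,
      integral_add ((hint.mono_set hSsub).const_mul a⁻¹) (integrableOn_const hSfin),
      integral_const_mul, setIntegral_const, smul_eq_mul]
  have hind : IntegrableOn
      (S.indicator (fun θ => a⁻¹ * ‖f (circleMap c R θ)‖ + (Real.log a - 1))) (Ioc 0 (2 * π)) :=
    ((integrable_indicator_iff hS).2 hintS).integrableOn
  rw [hSeq, ← integral_add hint hind]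
  refine integral_mono_ae hlog (hint.add hind) (ae_restrict_of_ae ?_)
  filter_upwards [hf.ae_circleMap_ne_zero hR hc] with θ hθ
  have hx : 0 < ‖f (circleMap c R θ)‖ := norm_pos_iff.2 hθ
  by_cases hθS : θ ∈ S
  · rw [indicator_of_mem hθS]
    have h1 := Real.log_le_sub_one_of_pos (mul_pos (inv_pos.2 ha) hx)
    rw [Real.log_mul (inv_pos.2 ha).ne' hx.ne', Real.log_inv] at h1
    linarith
  · rw [indicator_of_notMem hθS]
    linarith [Real.log_le_sub_one_of_pos hx]

/-- If integrable functions `g k`, bounded in `L¹(E)`, converge almost everywhere on `E` to `G`,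
then some `g k` has integral at most `∫_E ‖G‖ + η` over at least half of `E`. -/
lemma exists_setIntegral_norm_le_of_ae_tendsto {g : ℕ → ℝ → ℂ} {G : ℝ → ℂ} {E : Set ℝ} {C : ℝ}
    (hE : MeasurableSet E) (hE0 : 0 < volume E) (hEfin : volume E ≠ ⊤)
    (hint : ∀ k, IntegrableOn (g k) E) (hbd : ∀ k, ∫ θ in E, ‖g k θ‖ ≤ C)
    (hlim : ∀ᵐ θ ∂volume.restrict E, Tendsto (fun k => g k θ) atTop (𝓝 (G θ)))
    {η : ℝ} (hη : 0 < η) :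
    ∃ k, ∃ S ⊆ E, MeasurableSet S ∧ volume.real E / 2 ≤ volume.real S ∧
      ∫ θ in S, ‖g k θ‖ ≤ (∫ θ in E, ‖G θ‖) + η := by
  have : IsFiniteMeasure (volume.restrict E) := isFiniteMeasure_restrict.2 hEfin
  have hEr : 0 < volume.real E := ENNReal.toReal_pos hE0.ne' hEfin
  have hG : IntegrableOn G E := by
    refine memLp_one_iff_integrable.1
      ⟨aestronglyMeasurable_of_tendsto_ae _ (fun k => (hint k).aestronglyMeasurable) hlim, ?_⟩
    refine lt_of_le_of_lt (Lp.eLpNorm_le_of_ae_tendsto (C := ENNReal.ofReal C)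
      (Eventually.of_forall fun k => ?_)
      (fun k => (hint k).aestronglyMeasurable) hlim) ENNReal.ofReal_lt_top
    rw [eLpNorm_one_eq_lintegral_enorm, ← ofReal_integral_norm_eq_lintegral_enorm (hint k)]
    exact ENNReal.ofReal_le_ofReal (hbd k)
  have hmeas := tendstoInMeasure_of_tendsto_ae (fun k => (hint k).aestronglyMeasurable) hlim
  set δ : ℝ := η / volume.real E with hδ
  have hδ0 : 0 < δ := div_pos hη hEr
  have hev := (tendstoInMeasure_iff_norm.1 hmeas δ hδ0).eventually
    (gt_mem_nhds (show (0 : ENNReal) < volume E / 2 from ENNReal.half_pos hE0.ne'))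
  obtain ⟨k, hk⟩ := hev.exists
  set T := toMeasurable (volume.restrict E) {x | δ ≤ ‖g k x - G x‖} with hT
  have hTm : MeasurableSet T := measurableSet_toMeasurable _ _
  have hTE : volume.real (E ∩ T) ≤ volume.real E / 2 := by
    rw [← measure_toMeasurable, ← hT, Measure.restrict_apply hTm, inter_comm] at hk
    have := ENNReal.toReal_mono (ENNReal.div_ne_top hEfin two_ne_zero) hk.le
    simpa [Measure.real] using this
  refine ⟨k, E \ T, sdiff_subset, hE.diff hTm, ?_, ?_⟩
  · have := measureReal_sdiff_add_inter (μ := volume) (s := E) hTm hEfin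
    linarith
  · have hGn : IntegrableOn (fun θ => ‖G θ‖ + δ) E := hG.norm.add (integrableOn_const hEfin)
    calc ∫ θ in E \ T, ‖g k θ‖ ≤ ∫ θ in E \ T, (‖G θ‖ + δ) := by
          refine setIntegral_mono_on (IntegrableOn.mono_set (hint k).norm sdiff_subset)
            (hGn.mono_set sdiff_subset) (hE.diff hTm) fun θ hθ => ?_
          have h1 : ¬ δ ≤ ‖g k θ - G θ‖ := fun h => hθ.2 (subset_toMeasurable _ _ h)
          linarith [norm_sub_norm_le (g k θ) (G θ)]
      _ ≤ ∫ θ in E, (‖G θ‖ + δ) := by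
          refine setIntegral_mono_set hGn (Eventually.of_forall fun θ => ?_)
            sdiff_subset.eventuallyLE
          exact add_nonneg (norm_nonneg _) hδ0.le
      _ = (∫ θ in E, ‖G θ‖) + η := by
          rw [integral_add hG.norm (integrableOn_const hEfin), setIntegral_const, smul_eq_mul, hδ,
            mul_div_cancel₀ _ hEr.ne']

/-- A quantitative uniqueness estimate: a function in the unit ball of `H¹` whose boundary function
has small integral over `E` is small at the origin. -/
lemma norm_apply_zero_le_of_setIntegral_boundary_le {f : ℂ → ℂ} {F : ℝ → ℂ}
    (hdiff : DifferentiableOn ℂ f (ball (0:ℂ) 1))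
    (hnorm : ∀ r : ℝ, 0 ≤ r → r < 1 →
      (1 / (2*π)) * ∫ θ in (0:ℝ)..(2*π),
        ‖f ((r : ℂ) * Complex.exp ((θ : ℂ) * Complex.I))‖ ≤ 1)
    (hF : ∀ᵐ (θ : ℝ) ∂(volume.restrict (Set.Ioc (0:ℝ) (2*π))),
      Tendsto (fun r : ℝ => f ((r : ℂ) * Complex.exp ((θ : ℂ) * Complex.I)))
        (𝓝[<] (1:ℝ)) (𝓝 (F θ)))
    {E : Set ℝ} (hE : MeasurableSet E) (hEsub : E ⊆ Set.Ioc (0:ℝ) (2*π)) (hEpos : 0 < volume E)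
    {a : ℝ} (ha : 0 < a) (ha1 : a ≤ 1) (hFa : ∫ θ in E, ‖F θ‖ ≤ a) :
    ‖f 0‖ ≤ Real.exp ((2 * π + 2 + volume.real E / 2 * (Real.log a - 1)) / (2 * π)) := by
  rcases eq_or_ne (f 0) 0 with h0 | h0
  · rw [h0, norm_zero]
    exact (Real.exp_pos _).le
  have hpi : (0:ℝ) ≤ 2 * π := by positivity
  have hcm (r θ : ℝ) : (r : ℂ) * Complex.exp ((θ : ℂ) * Complex.I) = circleMap 0 r θ := by
    simp [circleMap]
  simp only [hcm] at hnorm hF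
  have hbound (r : ℝ) (hr0 : 0 ≤ r) (hr1 : r < 1) :
      ∫ θ in (0:ℝ)..(2*π), ‖f (circleMap 0 r θ)‖ ≤ 2 * π := by
    have := hnorm r hr0 hr1
    rwa [one_div_mul_eq_div, div_le_one (by positivity)] at this
  have han (r : ℝ) (hr1 : r < 1) : AnalyticOnNhd ℂ f (closedBall 0 r) :=
    (hdiff.analyticOnNhd isOpen_ball).mono (closedBall_subset_ball hr1)
  obtain ⟨ρ, -, hρ, hρlim⟩ := exists_seq_strictMono_tendsto' (zero_lt_one (α := ℝ))
  have hρw : Tendsto ρ atTop (𝓝[<] (1:ℝ)) :=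
    tendsto_nhdsWithin_iff.2 ⟨hρlim, Eventually.of_forall fun k => (hρ k).2⟩
  have hcont (k : ℕ) : Continuous fun θ => f (circleMap 0 (ρ k) θ) :=
    (han _ (hρ k).2).continuousOn.comp_continuous (continuous_circleMap 0 _)
      (fun θ => circleMap_mem_closedBall 0 (hρ k).1.le θ)
  have hint (k : ℕ) : IntegrableOn (fun θ => f (circleMap 0 (ρ k) θ)) (Ioc 0 (2 * π)) :=
    ((hcont k).intervalIntegrable 0 (2 * π)).1
  obtain ⟨k, S, hSE, hS, hSvol, hSint⟩ := exists_setIntegral_norm_le_of_ae_tendsto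
    (g := fun k θ => f (circleMap 0 (ρ k) θ)) (G := F) (C := 2 * π) hE hEpos
    (ne_top_of_le_ne_top measure_Ioc_lt_top.ne (measure_mono hEsub))
    (fun k => (hint k).mono_set hEsub)
    (fun k => by
      refine le_trans ?_ (hbound (ρ k) (hρ k).1.le (hρ k).2)
      rw [intervalIntegral.integral_of_le hpi]
      exact setIntegral_mono_set (hint k).norm (Eventually.of_forall fun θ => norm_nonneg _)
        hEsub.eventuallyLE)
    (by
      filter_upwards [ae_restrict_of_ae_restrict_of_subset hEsub hF] with θ hθ
      exact hθ.comp hρw) ha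
  have hJ := (han _ (hρ k).2).two_pi_mul_log_norm_le (hρ k).1 h0 hS (hSE.trans hEsub) ha
  have hb := hbound (ρ k) (hρ k).1.le (hρ k).2
  have h2 : a⁻¹ * (∫ θ in S, ‖f (circleMap 0 (ρ k) θ)‖) ≤ 2 := by
    rw [inv_mul_le_iff₀ ha]
    linarith
  have h3 : volume.real S * (Real.log a - 1) ≤ volume.real E / 2 * (Real.log a - 1) :=
    mul_le_mul_of_nonpos_right hSvol (by linarith [Real.log_nonpos ha.le ha1])
  rw [← Real.log_le_iff_le_exp (norm_pos_iff.2 h0), le_div_iff₀' (by positivity)]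
  linarith

/-- If `(fₙ)` are functions in the unit ball of the Hardy space `H¹` of the disc, with boundary
functions `Fₙ` (given by radial limits almost everywhere), and if `∫_E |Fₙ| → 0` for some
measurable subset `E` of the circle of positive measure, then `fₙ(0) → 0`. -/
theorem hardy_H1_boundary_vanishing (f : ℕ → ℂ → ℂ) (F : ℕ → ℝ → ℂ)
    (hdiff : ∀ n, DifferentiableOn ℂ (f n) (ball (0:ℂ) 1))
    (hnorm : ∀ n, ∀ r : ℝ, 0 ≤ r → r < 1 →
      (1 / (2*π)) * ∫ θ in (0:ℝ)..(2*π),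
        ‖f n ((r : ℂ) * Complex.exp ((θ : ℂ) * Complex.I))‖ ≤ 1)
    (hF : ∀ n, ∀ᵐ (θ : ℝ) ∂(volume.restrict (Set.Ioc (0:ℝ) (2*π))),
      Tendsto (fun r : ℝ => f n ((r : ℂ) * Complex.exp ((θ : ℂ) * Complex.I)))
        (𝓝[<] (1:ℝ)) (𝓝 (F n θ)))
    (E : Set ℝ) (hE : MeasurableSet E) (hEsub : E ⊆ Set.Ioc (0:ℝ) (2*π))
    (hEpos : 0 < volume E)
    (hlim : Tendsto (fun n => ∫ θ in E, ‖F n θ‖) atTop (𝓝 0)) :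
    Tendsto (fun n => f n 0) atTop (𝓝 0) := by
  have hEfin : volume E ≠ ⊤ := ne_top_of_le_ne_top measure_Ioc_lt_top.ne (measure_mono hEsub)
  have hEr : 0 < volume.real E := ENNReal.toReal_pos hEpos.ne' hEfin
  have hbound : Tendsto
      (fun a => Real.exp ((2 * π + 2 + volume.real E / 2 * (Real.log a - 1)) / (2 * π)))
      (𝓝[>] 0) (𝓝 0) := by
    refine Real.tendsto_exp_atBot.comp (Tendsto.atBot_div_const (by positivity) ?_)
    exact tendsto_atBot_add_const_left _ _ (Tendsto.const_mul_atBot (by positivity)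
      (tendsto_atBot_add_const_right _ _ Real.tendsto_log_nhdsGT_zero))
  rw [Metric.tendsto_atTop']
  intro ε hε
  obtain ⟨a, haε, ha0, ha1⟩ := ((hbound.eventually (gt_mem_nhds hε)).and
    (Ioc_mem_nhdsGT (zero_lt_one (α := ℝ)))).exists
  obtain ⟨N, hN⟩ := eventually_atTop.1 (hlim.eventually (gt_mem_nhds ha0))
  refine ⟨N, fun n hn => ?_⟩
  rw [dist_zero_right]
  exact (norm_apply_zero_le_of_setIntegral_boundary_le (hdiff n) (hnorm n) (hF n) hE hEsub hEpos
    ha0 ha1 (hN n hn.le).le).trans_lt haε
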